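/- Let p ≥ 1 and let μ be a probability measure on [0,1]^p having a density p_X with respect to Lebesgue measure with 0 < θ̲ ≤ p_X(u) ≤ θ̄ < ∞ for all u ∈ [0,1]^p, where θ̲ ≤ 1 ≤ θ̄; let X ~ μ. Suppose f*: [0,1]^p → ℝ is additive, f*(u) = f*_1(u_1) + ⋯ + f*_p(u_p), where each component f*_k is differentiable on [0,1] and belongs to the class LRP([0,1], τ) for some τ > 0. Then f* satisfies the Sufficient Impurity Decrease condition with parameter λ = 4θ̲/(p τ² θ̄): for every rectangle A ⊆ [0,1]^p (a product of intervals), sup_{j ∈ {1,…,p}, b ∈ ℝ} Δ(A, j, b) ≥ (4θ̲/(p τ² θ̄)) · P(X ∈ A) · Var(f*(X) | X ∈ A). -/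

import Mathlib

open MeasureTheory Set Filter
open scoped ENNReal Classical

noncomputable section

/-- The unit cube `[0,1]^p`. -/
def box (p : ℕ) : Set (Fin p → ℝ) := Set.univ.pi fun _ => Set.Icc (0 : ℝ) 1

/-- Conditional mean `E[f(X) | X ∈ A]` (equal to `0` when `μ A = 0`). -/
def condMean {p : ℕ} (μ : Measure (Fin p → ℝ)) (f : (Fin p → ℝ) → ℝ)
    (A : Set (Fin p → ℝ)) : ℝ :=
  (∫ x in A, f x ∂μ) / (μ A).toReal

/-- Conditional variance `Var(f(X) | X ∈ A)` (equal to `0` when `μ A = 0`). -/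
def condVar {p : ℕ} (μ : Measure (Fin p → ℝ)) (f : (Fin p → ℝ) → ℝ)
    (A : Set (Fin p → ℝ)) : ℝ :=
  (∫ x in A, (f x - condMean μ f A) ^ 2 ∂μ) / (μ A).toReal

/-- Left cell `A_L(j,b) = A ∩ {v : v_j ≤ b}`. -/
def cellL {p : ℕ} (A : Set (Fin p → ℝ)) (j : Fin p) (b : ℝ) : Set (Fin p → ℝ) :=
  A ∩ {v | v j ≤ b}

/-- Right cell `A_R(j,b) = A ∩ {v : v_j > b}`. -/
def cellR {p : ℕ} (A : Set (Fin p → ℝ)) (j : Fin p) (b : ℝ) : Set (Fin p → ℝ) :=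
  A ∩ {v | b < v j}

/-- Population impurity decrease `Δ(A, j, b)`. -/
def impurity {p : ℕ} (μ : Measure (Fin p → ℝ)) (f : (Fin p → ℝ) → ℝ)
    (A : Set (Fin p → ℝ)) (j : Fin p) (b : ℝ) : ℝ :=
  (μ A).toReal * condVar μ f A
    - (μ (cellL A j b)).toReal * condVar μ f (cellL A j b)
    - (μ (cellR A j b)).toReal * condVar μ f (cellR A j b)

/-- The Locally Reverse Poincaré class: `g` (with derivative `g'`) is in `LRP(Q, τ)` if
for every subinterval `[a,b] ⊆ Q`,
`(∫_a^b |g'|)² ≤ (τ²/(b-a)) · inf_w ∫_a^b |g - w|²`. -/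
def LRPOn (g g' : ℝ → ℝ) (Q : Set ℝ) (τ : ℝ) : Prop :=
  ∀ a b : ℝ, a < b → Set.Icc a b ⊆ Q →
    (∫ t in a..b, |g' t|) ^ 2 ≤ τ ^ 2 / (b - a) * ⨅ w : ℝ, ∫ t in a..b, |g t - w| ^ 2


lemma ord_eq_Ioo (J : Set ℝ) (hJo : IsOpen J) (hJ : J.OrdConnected) (hb : J ⊆ Icc 0 1) (hne : J.Nonempty) :
    J = Ioo (sInf J) (sSup J) := by
  have b1 : BddBelow J := ⟨0, fun x hx => (hb hx).1⟩
  have b2 : BddAbove J := ⟨1, fun x hx => (hb hx).2⟩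
  ext x
  constructor
  · intro hx
    obtain ⟨e, he, hball⟩ := Metric.isOpen_iff.1 hJo x hx
    have h1 : x - e/2 ∈ J := hball (by rw [Metric.mem_ball, Real.dist_eq, abs_lt]; constructor <;> linarith)
    have h2 : x + e/2 ∈ J := hball (by rw [Metric.mem_ball, Real.dist_eq, abs_lt]; constructor <;> linarith)
    have := csInf_le b1 h1
    have := le_csSup b2 h2
    constructor <;> linarith
  · rintro ⟨h1, h2⟩
    obtain ⟨y, hy, hyx⟩ := exists_lt_of_csInf_lt hne h1
    obtain ⟨z, hz, hzx⟩ := exists_lt_of_lt_csSup hne h2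
    exact hJ.out hy hz ⟨hyx.le, hzx.le⟩

lemma lintegral_ord_le (h : ℝ → ℝ) (hm : AEMeasurable h) (J : Set ℝ) (hJo : IsOpen J)
    (hJ : J.OrdConnected) (hb : J ⊆ Icc 0 1)
    (hint : ∀ x ∈ J, IntegrableAtFilter h (nhds x) volume) (C : ℝ)
    (hC : ∀ a b, a < b → Icc a b ⊆ J → ∫ t in a..b, |h t| ≤ C) :
    ∫⁻ t in J, ‖h t‖ₑ ≤ ENNReal.ofReal C := by
  rcases J.eq_empty_or_nonempty with he | hne
  · simp [he]
  have hJe := ord_eq_Ioo J hJo hJ hb hne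
  set c := sInf J
  set d := sSup J
  have hcd : c < d := by
    obtain ⟨x, hx⟩ := hne
    rw [hJe] at hx
    exact hx.1.trans hx.2
  have t0 : Tendsto (fun n : ℕ => (d - c) / ((n : ℝ) + 3)) atTop (nhds 0) := by
    apply Tendsto.div_atTop tendsto_const_nhds
    exact tendsto_atTop_add_const_right _ _ tendsto_natCast_atTop_atTop
  have ta : Tendsto (fun n : ℕ => c + (d - c) / ((n : ℝ) + 3)) atTop (nhds c) := by
    simpa using tendsto_const_nhds.add t0
  have tb : Tendsto (fun n : ℕ => d - (d - c) / ((n : ℝ) + 3)) atTop (nhds d) := by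
    simpa using tendsto_const_nhds.sub t0
  have cov := aecover_Ioo_of_Icc (μ := (volume : Measure ℝ)) ta tb
  have key := cov.lintegral_tendsto_of_nat (f := fun t => ‖h t‖ₑ) (hm.restrict.enorm)
  rw [← hJe] at key
  refine le_of_tendsto' key fun n => ?_
  have hpos : 0 < (d - c) / ((n : ℝ) + 3) := by
    apply div_pos <;> [linarith; positivity]
  have hlt : (d - c) / ((n : ℝ) + 3) ≤ (d - c) / 3 := by
    apply div_le_div_of_nonneg_left <;> [linarith; norm_num; linarith [(Nat.cast_nonneg n : (0:ℝ) ≤ n)]]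
  set q := (d - c) / ((n : ℝ) + 3)
  have hsub : Icc (c + q) (d - q) ⊆ J := by
    rw [hJe]; intro x hx; exact ⟨by linarith [hx.1], by linarith [hx.2]⟩
  have hi : IntegrableOn h (Icc (c + q) (d - q)) := by
    apply LocallyIntegrableOn.integrableOn_isCompact _ isCompact_Icc
    intro x hx
    exact (hint x (hsub hx)).filter_mono nhdsWithin_le_nhds
  have := hC (c + q) (d - q) (by linarith) hsub
  rw [Measure.restrict_restrict measurableSet_Icc, inter_eq_left.2 hsub]
  rw [← ofReal_integral_norm_eq_lintegral_enorm hi]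
  apply ENNReal.ofReal_le_ofReal
  rw [intervalIntegral.integral_of_le (by linarith), ← integral_Icc_eq_integral_Ioc] at this
  simpa using this

lemma lintegral_comp_le (h : ℝ → ℝ) (O : Set ℝ) (hO : IsOpen O) (D : ℝ≥0∞)
    (H : ∀ x ∈ O, ∫⁻ t in connectedComponentIn O x, ‖h t‖ₑ ≤ D * volume (connectedComponentIn O x)) :
    ∫⁻ t in O, ‖h t‖ₑ ≤ D * volume O := by
  set S : Set (Set ℝ) := connectedComponentIn O '' O with hS
  have hopen : ∀ s ∈ S, IsOpen s := by
    rintro _ ⟨x, hx, rfl⟩; exact hO.connectedComponentIn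
  have hdis : S.PairwiseDisjoint id := by
    rintro _ ⟨x, hx, rfl⟩ _ ⟨y, hy, rfl⟩ hne
    refine Set.disjoint_left.2 fun z hz hz' => hne ?_
    exact (connectedComponentIn_eq hz).trans (connectedComponentIn_eq hz').symm
  have hc : S.Countable := hdis.countable_of_isOpen hopen (by
    rintro _ ⟨x, hx, rfl⟩; exact ⟨x, mem_connectedComponentIn hx⟩)
  have hU : O = ⋃ s ∈ S, s := by
    ext x; constructor
    · intro hx
      exact mem_biUnion (mem_image_of_mem _ hx) (mem_connectedComponentIn hx)
    · intro hx
      simp only [mem_iUnion] at hx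
      obtain ⟨_, ⟨y, hy, rfl⟩, hx⟩ := hx
      exact connectedComponentIn_subset _ _ hx
  have e1 := lintegral_biUnion (μ := (volume : Measure ℝ)) hc (fun i hi => (hopen i hi).measurableSet) hdis (fun t => ‖h t‖ₑ)
  have e2 := measure_biUnion (μ := (volume : Measure ℝ)) hc hdis (fun i hi => (hopen i hi).measurableSet)
  simp only [id] at e1 e2
  rw [← hU] at e1 e2
  rw [e1, e2, ← ENNReal.tsum_mul_left]
  refine ENNReal.tsum_le_tsum ?_
  rintro ⟨_, ⟨x, hx, rfl⟩⟩
  exact H x hx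

lemma abs_sub_le_vol (J : Set ℝ) (hJ : J.OrdConnected) (hfin : volume J ≠ ⊤) (t z : ℝ) (ht : t ∈ J)
    (hz : z ∈ closure J) : |t - z| ≤ (volume J).toReal := by
  have : Ioo (min t z) (max t z) ⊆ J := by
    intro y hy
    rcases le_total t z with h | h
    · rw [min_eq_left h, max_eq_right h] at hy
      obtain ⟨w, hw, hwJ⟩ := mem_closure_iff.1 hz (Ioi y) isOpen_Ioi hy.2
      exact hJ.out ht hwJ ⟨hy.1.le, le_of_lt hw⟩
    · rw [min_eq_right h, max_eq_left h] at hy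
      obtain ⟨w, hw, hwJ⟩ := mem_closure_iff.1 hz (Iio y) isOpen_Iio hy.1
      exact hJ.out hwJ ht ⟨le_of_lt hw, hy.2.le⟩
  have h2 := ENNReal.toReal_mono hfin (measure_mono (μ := volume) this)
  rw [Real.volume_Ioo, ENNReal.toReal_ofReal (by simp), max_sub_min_eq_abs] at h2
  rwa [abs_sub_comm]

lemma exists_closure_mem (K : Set ℝ) (hK : IsClosed K) (α β x0 : ℝ) (hx0 : x0 ∈ Ioo α β) (hx0K : x0 ∈ K)
    (x : ℝ) (hx : x ∈ Ioo α β \ K) :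
    ∃ z ∈ K, z ∈ Ioo α β ∧ z ∈ closure (connectedComponentIn (Ioo α β \ K) x) := by
  by_contra hcon
  push Not at hcon
  set O := Ioo α β \ K with hOdef
  have hO : IsOpen O := isOpen_Ioo.sdiff hK
  set J := connectedComponentIn O x with hJ
  have hJo : IsOpen J := hO.connectedComponentIn
  have hxJ : x ∈ J := mem_connectedComponentIn hx
  have pc : IsPreconnected (Ioo α β) := isPreconnected_Ioo
  obtain ⟨y, -, hy1, hy2⟩ := pc J (closure J)ᶜ hJo isClosed_closure.isOpen_compl (by
    intro y hy
    by_cases hyc : y ∈ closure J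
    · left
      have hyK : y ∉ K := fun hk => hcon y hk hy hyc
      have hyO : y ∈ O := ⟨hy, hyK⟩
      obtain ⟨w, hw, hwJ⟩ := mem_closure_iff.1 hyc _ (hO.connectedComponentIn (x := y)) (mem_connectedComponentIn hyO)
      have : J = connectedComponentIn O y := (connectedComponentIn_eq hwJ).trans (connectedComponentIn_eq hw).symm
      rw [this]; exact mem_connectedComponentIn hyO
    · right; exact hyc) ⟨x, hx.1, hxJ⟩ ⟨x0, hx0, hcon x0 hx0K hx0⟩
  exact hy2 (subset_closure hy1)

lemma LRPOn.le {g g' : ℝ → ℝ} {Q : Set ℝ} {τ : ℝ} (H : LRPOn g g' Q τ) (a b : ℝ) (hab : a < b)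
    (hs : Icc a b ⊆ Q) (w : ℝ) :
    (∫ t in a..b, |g' t|) ^ 2 ≤ τ ^ 2 / (b - a) * ∫ t in a..b, |g t - w| ^ 2 := by
  refine (H a b hab hs).trans ?_
  apply mul_le_mul_of_nonneg_left
  · apply ciInf_le
    refine ⟨0, ?_⟩
    rintro _ ⟨w, rfl⟩
    exact intervalIntegral.integral_nonneg hab.le (fun t _ => by positivity)
  · apply div_nonneg (sq_nonneg _); linarith

lemma lrp_integrable (g g' : ℝ → ℝ) (τ : ℝ) (hτ : 0 < τ) (hg : Continuous g)
    (hd : ∀ t ∈ Icc (0 : ℝ) 1, HasDerivWithinAt g (g' t) (Icc (0 : ℝ) 1) t)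
    (hL : LRPOn g g' (Icc 0 1) τ) : IntegrableOn g' (Icc 0 1) := by
  have hd' : ∀ t ∈ Ioo (0 : ℝ) 1, HasDerivAt g (g' t) t := fun t ht =>
    (hd t (Ioo_subset_Icc_self ht)).hasDerivAt (Icc_mem_nhds ht.1 ht.2)
  set h : ℝ → ℝ := (Ioo (0:ℝ) 1).indicator (deriv g) with hh
  have hhg : ∀ t ∈ Ioo (0 : ℝ) 1, h t = g' t := fun t ht => by
    rw [hh, indicator_of_mem ht, (hd' t ht).deriv]
  have hm : Measurable h := (measurable_deriv g).indicator measurableSet_Ioo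
  set K : Set ℝ := {x | ¬ IntegrableAtFilter h (nhds x) volume} with hKdef
  have hK : IsClosed K := by
    rw [← isOpen_compl_iff, isOpen_iff_mem_nhds]
    intro x hx
    obtain ⟨s, hs, hi⟩ := not_not.1 hx
    filter_upwards [interior_mem_nhds.2 hs] with y hy
    exact not_not.2 ⟨s, mem_interior_iff_mem_nhds.1 hy, hi⟩
  have hK01 : K ⊆ Icc 0 1 := by
    intro x hx
    by_contra hc
    refine hx ⟨(Icc 0 1)ᶜ, isClosed_Icc.isOpen_compl.mem_nhds hc, ?_⟩
    refine (integrableOn_zero (ε' := ℝ)).congr_fun ?_ measurableSet_Icc.compl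
    intro y hy
    rw [hh, indicator_of_notMem]
    exact fun hy' => hy (Ioo_subset_Icc_self hy')
  have hKe : K = ∅ := by
    by_contra hne
    obtain ⟨k0, hk0⟩ := Set.nonempty_iff_ne_empty.2 hne
    have : Nonempty K := ⟨⟨k0, hk0⟩⟩
    have : CompleteSpace K := hK.completeSpace_coe
    set F : ℕ → Set K := fun n => {x | ∀ y ∈ Icc (0:ℝ) 1, |y - x| < 1 / ((n:ℝ) + 1) →
      |g y - g x| ≤ ((n:ℝ) + 1) * |y - x|} with hF
    have hFc : ∀ n, IsClosed (F n) := by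
      intro n
      have : F n = ⋂ y ∈ Icc (0:ℝ) 1, ({x : K | 1 / ((n:ℝ) + 1) ≤ |y - x|} ∪
          {x : K | |g y - g x| ≤ ((n:ℝ) + 1) * |y - x|}) := by
        ext x
        simp only [hF, mem_ofPred_eq, mem_iInter, mem_union]
        refine forall₂_congr fun y hy => ?_
        rw [imp_iff_not_or, not_lt]
      rw [this]
      refine isClosed_biInter fun y hy => IsClosed.union ?_ ?_
      · exact isClosed_le continuous_const (by fun_prop)
      · exact isClosed_le (by fun_prop) (by fun_prop)
    have hFu : ⋃ n, F n = univ := by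
      refine eq_univ_of_forall fun x => ?_
      have hb := ((hd x (hK01 x.2)).hasFDerivWithinAt).isBigO_sub
      obtain ⟨C, hC⟩ := hb.bound
      obtain ⟨e, he, hball⟩ := Metric.mem_nhdsWithin_iff.1 hC
      obtain ⟨n1, hn1⟩ := exists_nat_gt C
      obtain ⟨n2, hn2⟩ := exists_nat_one_div_lt he
      refine mem_iUnion.2 ⟨max n1 n2, ?_⟩
      intro y hy hyx
      have h1 : (1:ℝ) / ((max n1 n2 : ℕ) + 1) ≤ 1 / ((n2:ℝ) + 1) := by
        apply one_div_le_one_div_of_le (by positivity)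
        have : (n2:ℝ) ≤ (max n1 n2 : ℕ) := by exact_mod_cast le_max_right _ _
        linarith
      have h2 : (n1:ℝ) ≤ (max n1 n2 : ℕ) := by exact_mod_cast le_max_left _ _
      have h3 := hball ⟨by rw [Metric.mem_ball, Real.dist_eq]; linarith, hy⟩
      simp only [mem_ofPred_eq, Real.norm_eq_abs] at h3
      refine h3.trans ?_
      gcongr
      linarith
    obtain ⟨n, ⟨x0, hx0⟩⟩ := nonempty_interior_of_iUnion_of_closed hFc hFu
    rw [mem_interior_iff_mem_nhds, Metric.mem_nhds_iff] at hx0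
    obtain ⟨r, hr, hball⟩ := hx0
    set M : ℝ := (n:ℝ) + 1 with hM
    have hMpos : 0 < M := by positivity
    set s : ℝ := min r (1 / M / 2) with hs
    have hspos : 0 < s := lt_min hr (by positivity)
    set α := (x0:ℝ) - s
    set β := (x0:ℝ) + s
    have hx0m : (x0:ℝ) ∈ Ioo α β := ⟨by simp only [α]; linarith, by simp only [β]; linarith⟩
    have hlip : ∀ z ∈ K, z ∈ Ioo α β → ∀ y ∈ Icc (0:ℝ) 1, |y - z| < 1 / M → |g y - g z| ≤ M * |y - z| := by
      intro z hz hz'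
      have : (⟨z, hz⟩ : K) ∈ F n := hball (by
        rw [Metric.mem_ball, Subtype.dist_eq, Real.dist_eq, abs_lt]
        have := min_le_left r (1 / M / 2)
        simp only [α, β, mem_Ioo] at hz'
        constructor <;> linarith [hz'.1, hz'.2])
      exact this
    have hdist : ∀ y ∈ Ioo α β, ∀ z ∈ Ioo α β, |y - z| < 1 / M := by
      intro y hy z hz
      have := min_le_right r (1 / M / 2)
      simp only [α, β, mem_Ioo] at hz hy
      rw [abs_lt]; constructor <;> linarith [hz.1, hz.2, hy.1, hy.2]
    refine x0.2 ⟨Ioo α β, Ioo_mem_nhds hx0m.1 hx0m.2, hm.aestronglyMeasurable.restrict, ?_⟩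
    have hO : IsOpen (Ioo α β \ K) := isOpen_Ioo.sdiff hK
    have hOfin : ∀ s ⊆ Ioo α β, volume s ≠ ⊤ := fun s hs =>
      ne_top_of_le_ne_top (by simp : volume (Ioo α β) ≠ ⊤) (measure_mono hs)
    have hpartO : ∫⁻ t in Ioo α β \ K, ‖h t‖ₑ ≤ ENNReal.ofReal (τ * M) * volume (Ioo α β \ K) := by
      apply lintegral_comp_le h _ hO
      intro x hx
      obtain ⟨z, hzK, hzI, hzc⟩ := exists_closure_mem K hK α β x0 hx0m x0.2 x hx
      set J := connectedComponentIn (Ioo α β \ K) x with hJ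
      have hJO : J ⊆ Ioo α β \ K := connectedComponentIn_subset _ _
      have hJo : IsOpen J := hO.connectedComponentIn
      have hJc : J.OrdConnected := isPreconnected_connectedComponentIn.ordConnected
      have hJfin : volume J ≠ ⊤ := hOfin _ fun y hy => (hJO hy).1
      rw [← lintegral_inter_add_sdiff (fun t => ‖h t‖ₑ) J (measurableSet_Ioo (a := (0:ℝ)) (b := 1))]
      have hzero : ∫⁻ t in J \ Ioo 0 1, ‖h t‖ₑ = 0 := by
        rw [setLIntegral_congr_fun (g := fun _ => 0) (hJo.measurableSet.diff measurableSet_Ioo)]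
        · simp
        · intro y hy
          simp [hh, indicator_of_notMem hy.2]
      rw [hzero, add_zero, ← ENNReal.ofReal_toReal hJfin, ← ENNReal.ofReal_mul (by positivity)]
      apply lintegral_ord_le h hm.aemeasurable _ (hJo.inter isOpen_Ioo) (hJc.inter ordConnected_Ioo)
        (fun y hy => Ioo_subset_Icc_self hy.2) (fun y hy => not_not.1 (hJO hy.1).2)
      intro a b hab hsub
      have hsub1 : Icc a b ⊆ Icc 0 1 := fun y hy => Ioo_subset_Icc_self (hsub hy).2
      have e1 : ∫ t in a..b, |h t| = ∫ t in a..b, |g' t| := by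
        apply intervalIntegral.integral_congr
        intro y hy
        rw [uIcc_of_le hab.le] at hy
        simp only [hhg y (hsub hy).2]
      rw [e1]
      have e2 := hL.le a b hab hsub1 (g z)
      set L := (volume J).toReal
      have e3 : ∫ t in a..b, |g t - g z| ^ 2 ≤ ∫ t in a..b, (M * L) ^ 2 := by
        apply intervalIntegral.integral_mono_on hab.le
        · apply Continuous.intervalIntegrable; fun_prop
        · simp
        · intro y hy
          have hyJ := (hsub hy).1
          have f1 := hlip z hzK hzI y (hsub1 hy) (hdist y (hJO hyJ).1 z hzI)
          have f2 := abs_sub_le_vol J hJc hJfin y z hyJ hzc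
          have f3 : |g y - g z| ≤ M * L := f1.trans (by gcongr)
          gcongr
      rw [intervalIntegral.integral_const, smul_eq_mul] at e3
      have hba : 0 < b - a := by linarith
      have e4 : (∫ t in a..b, |g' t|) ^ 2 ≤ (τ * M * L) ^ 2 := by
        calc _ ≤ _ := e2
          _ ≤ τ ^ 2 / (b - a) * ((b - a) * (M * L) ^ 2) := by gcongr
          _ = _ := by field_simp
      exact le_of_sq_le_sq e4 (by positivity)
    have hpartK : ∫⁻ t in Ioo α β ∩ K, ‖h t‖ₑ ≤ ENNReal.ofReal M * volume (Ioo α β ∩ K) := by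
      rw [← setLIntegral_const]
      apply setLIntegral_mono' (measurableSet_Ioo.inter hK.measurableSet)
      intro x hx
      rw [Real.enorm_eq_ofReal_abs]
      apply ENNReal.ofReal_le_ofReal
      by_cases hx1 : x ∈ Ioo (0:ℝ) 1
      · rw [hhg x hx1]
        apply (hd' x hx1).le_of_lip' hMpos.le
        filter_upwards [Ioo_mem_nhds hx1.1 hx1.2, Ioo_mem_nhds hx.1.1 hx.1.2] with y hy hy2
        exact hlip x hx.2 hx.1 y (Ioo_subset_Icc_self hy) (hdist y hy2 x hx.1)
      · rw [hh, indicator_of_notMem hx1]; simpa using hMpos.le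
    rw [hasFiniteIntegral_iff_enorm, ← lintegral_inter_add_sdiff (fun t => ‖h t‖ₑ) _ hK.measurableSet]
    refine ENNReal.add_lt_top.2 ⟨hpartK.trans_lt ?_, hpartO.trans_lt ?_⟩
    · exact ENNReal.mul_lt_top ENNReal.ofReal_lt_top (lt_top_iff_ne_top.2 (hOfin _ inter_subset_left))
    · exact ENNReal.mul_lt_top ENNReal.ofReal_lt_top (lt_top_iff_ne_top.2 (hOfin _ sdiff_subset))
  have hi : IntegrableOn h (Icc 0 1) := by
    apply LocallyIntegrableOn.integrableOn_isCompact _ isCompact_Icc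
    intro x hx
    refine IntegrableAtFilter.filter_mono nhdsWithin_le_nhds ?_
    by_contra hc
    have : x ∈ K := hc
    rw [hKe] at this; exact this
  rw [integrableOn_Icc_iff_integrableOn_Ioo] at hi ⊢
  exact hi.congr_fun (fun t ht => hhg t ht) measurableSet_Ioo

lemma ibp_bound {Ω : Type*} [MeasurableSpace Ω] (ν : Measure Ω) [IsFiniteMeasure ν] (h : Ω → ℝ)
    (hh : Integrable h ν) (h0 : ∫ ω, h ω ∂ν = 0) (X : Ω → ℝ) (hX : Measurable X) (a b : ℝ)
    (hab : a ≤ b) (hXab : ∀ᵐ ω ∂ν, X ω ∈ Icc a b) (φ φ' : ℝ → ℝ)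
    (hφ : IntegrableOn φ' (Icc a b))
    (hF : ∀ x ∈ Icc a b, φ x = φ b - ∫ t in x..b, φ' t) (S : ℝ)
    (hS : ∀ t, |∫ ω in {ω | X ω ≤ t}, h ω ∂ν| ≤ S) :
    |∫ ω, h ω * φ (X ω) ∂ν| ≤ S * ∫ t in a..b, |φ' t| := by
  set lam := (volume : Measure ℝ).restrict (Icc a b) with hl
  set k : Ω × ℝ → ℝ := {p : Ω × ℝ | X p.1 ≤ p.2}.indicator (fun p => h p.1 * φ' p.2) with hk
  have hms : MeasurableSet {p : Ω × ℝ | X p.1 ≤ p.2} :=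
    measurableSet_le (hX.comp measurable_fst) measurable_snd
  have hki : Integrable k (ν.prod lam) := (hh.mul_prod hφ).indicator hms
  have hsw := integral_integral_swap (f := fun ω t => k (ω, t)) hki
  have e1 : ∀ᵐ ω ∂ν, h ω * φ (X ω) = h ω * φ b - ∫ t, k (ω, t) ∂lam := by
    filter_upwards [hXab] with ω hω
    rw [hF _ hω, mul_sub]
    congr 1
    have : (fun t => k (ω, t)) = fun t => h ω * (Ici (X ω)).indicator φ' t := by
      ext t
      by_cases ht : X ω ≤ t
      · simp [hk, indicator, ht]
      · simp [hk, indicator, ht]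
    rw [this, integral_const_mul, integral_indicator measurableSet_Ici, hl,
      Measure.restrict_restrict measurableSet_Ici, intervalIntegral.integral_of_le hω.2,
      ← integral_Icc_eq_integral_Ioc]
    congr 3
    ext t; constructor
    · rintro ⟨h1, h2⟩; exact ⟨h1, hω.1.trans h1, h2⟩
    · rintro ⟨h1, h2⟩; exact ⟨h1, h2.2⟩
  rw [integral_congr_ae e1, integral_sub (hh.mul_const _) hki.integral_prod_left, integral_mul_const,
    h0, zero_mul, zero_sub, abs_neg, hsw]
  have e2 : ∀ t, ∫ ω, k (ω, t) ∂ν = (∫ ω in {ω | X ω ≤ t}, h ω ∂ν) * φ' t := by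
    intro t
    rw [← integral_mul_const]
    exact integral_indicator (f := fun ω => h ω * φ' t) (measurableSet_le hX measurable_const)
  simp_rw [e2]
  rw [intervalIntegral.integral_of_le hab, ← integral_Icc_eq_integral_Ioc, ← integral_const_mul]
  refine norm_integral_le_of_norm_le (μ := lam) (f := fun t => (∫ ω in {ω | X ω ≤ t}, h ω ∂ν) * φ' t)
    (g := fun t => S * |φ' t|) (Integrable.const_mul (Integrable.abs hφ) S) (Eventually.of_forall fun t => ?_)
  rw [norm_mul, Real.norm_eq_abs, Real.norm_eq_abs]
  exact mul_le_mul_of_nonneg_right (hS t) (abs_nonneg _)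

lemma mul_condVar {p : ℕ} (μ : Measure (Fin p → ℝ)) [IsFiniteMeasure μ] (F : (Fin p → ℝ) → ℝ)
    (B : Set (Fin p → ℝ)) (h1 : IntegrableOn F B μ) (h2 : IntegrableOn (fun x => F x ^ 2) B μ) (m : ℝ) :
    (μ B).toReal * condVar μ F B = ∫ x in B, (F x - m) ^ 2 ∂μ
      - (∫ x in B, (F x - m) ∂μ) ^ 2 / (μ B).toReal := by
  by_cases h0 : (μ B).toReal = 0
  · have : μ B = 0 := by
      rcases (ENNReal.toReal_eq_zero_iff _).1 h0 with h | h
      · exact h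
      · exact absurd h (measure_ne_top _ _)
    simp [Measure.restrict_eq_zero.2 this, this]
  · set P := (μ B).toReal with hP
    have hconst : ∀ c : ℝ, ∫ x in B, c ∂μ = P * c := by
      intro c; rw [setIntegral_const]; rfl
    have hic : ∀ c : ℝ, IntegrableOn (fun _ => c) B μ := fun c => integrable_const c
    have hsub : ∀ c : ℝ, ∫ x in B, (F x - c) ∂μ = (∫ x in B, F x ∂μ) - P * c := by
      intro c; rw [integral_sub h1 (hic c), hconst]
    have hsq : ∀ c : ℝ, ∫ x in B, (F x - c) ^ 2 ∂μ
        = (∫ x in B, F x ^ 2 ∂μ) - 2 * c * (∫ x in B, F x ∂μ) + P * c ^ 2 := by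
      intro c
      have : ∀ x, (F x - c) ^ 2 = F x ^ 2 - 2 * c * F x + c ^ 2 := fun x => by ring
      simp_rw [this]
      have i3 : IntegrableOn (fun x => F x ^ 2 - 2 * c * F x) B μ := h2.sub (h1.const_mul _)
      rw [integral_add i3 (hic _), integral_sub h2 (h1.const_mul _), hconst,
        integral_const_mul]
    unfold condVar condMean
    rw [← hP, hsq, hsq, hsub]
    field_simp
    ring

lemma impurity_bounds {p : ℕ} (μ : Measure (Fin p → ℝ)) [IsFiniteMeasure μ] (F : (Fin p → ℝ) → ℝ)
    (A : Set (Fin p → ℝ)) (hA : MeasurableSet A)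
    (h1 : IntegrableOn F A μ) (h2 : IntegrableOn (fun x => F x ^ 2) A μ) (hpos : 0 < (μ A).toReal)
    (j : Fin p) (b : ℝ) :
    4 * (∫ x in cellL A j b, (F x - condMean μ F A) ∂μ) ^ 2 ≤ (μ A).toReal * impurity μ F A j b ∧
      impurity μ F A j b ≤ (μ A).toReal * condVar μ F A := by
  set m := condMean μ F A with hm
  have hLs : cellL A j b ⊆ A := inter_subset_left
  have hRs : cellR A j b ⊆ A := inter_subset_left
  have hRm : MeasurableSet (cellR A j b) :=
    hA.inter (measurableSet_lt measurable_const (measurable_pi_apply j))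
  have hdis : Disjoint (cellL A j b) (cellR A j b) := by
    refine Set.disjoint_left.2 ?_
    rintro x ⟨_, hx⟩ ⟨_, hx'⟩
    exact not_le.2 (show b < x j from hx') hx
  have hun : A = cellL A j b ∪ cellR A j b := by
    ext x; constructor
    · intro hx
      rcases le_or_gt (x j) b with h | h
      · exact Or.inl ⟨hx, h⟩
      · exact Or.inr ⟨hx, h⟩
    · rintro (h | h) <;> exact h.1
  have i1 : IntegrableOn (fun x => F x - m) A μ := h1.sub (integrable_const m)
  have i2 : IntegrableOn (fun x => (F x - m) ^ 2) A μ := by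
    have : (fun x => (F x - m) ^ 2) = fun x => F x ^ 2 - 2 * m * F x + m ^ 2 := by ext x; ring
    rw [this]
    exact (h2.sub (h1.const_mul _)).add (integrable_const _)
  have eI : ∫ x in A, (F x - m) ∂μ = ∫ x in cellL A j b, (F x - m) ∂μ + ∫ x in cellR A j b, (F x - m) ∂μ := by
    conv_lhs => rw [hun]
    exact setIntegral_union hdis hRm (i1.mono_set hLs) (i1.mono_set hRs)
  have eQ : ∫ x in A, (F x - m) ^ 2 ∂μ = ∫ x in cellL A j b, (F x - m) ^ 2 ∂μ
      + ∫ x in cellR A j b, (F x - m) ^ 2 ∂μ := by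
    conv_lhs => rw [hun]
    exact setIntegral_union hdis hRm (i2.mono_set hLs) (i2.mono_set hRs)
  have eP : (μ A).toReal = (μ (cellL A j b)).toReal + (μ (cellR A j b)).toReal := by
    conv_lhs => rw [hun]
    rw [measure_union hdis hRm, ENNReal.toReal_add (measure_ne_top _ _) (measure_ne_top _ _)]
  have e0 : ∫ x in A, (F x - m) ∂μ = 0 := by
    rw [integral_sub h1 (integrable_const m), setIntegral_const, hm, condMean]
    simp only [Measure.real, smul_eq_mul]
    field_simp
    ring
  have zL : (μ (cellL A j b)).toReal = 0 → ∫ x in cellL A j b, (F x - m) ∂μ = 0 := by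
    intro h
    rcases (ENNReal.toReal_eq_zero_iff _).1 h with h | h
    · simp [Measure.restrict_eq_zero.2 h]
    · exact absurd h (measure_ne_top _ _)
  have zR : (μ (cellR A j b)).toReal = 0 → ∫ x in cellR A j b, (F x - m) ∂μ = 0 := by
    intro h
    rcases (ENNReal.toReal_eq_zero_iff _).1 h with h | h
    · simp [Measure.restrict_eq_zero.2 h]
    · exact absurd h (measure_ne_top _ _)
  constructor
  · unfold impurity
    rw [mul_condVar μ F A h1 h2 m, mul_condVar μ F _ (h1.mono_set hLs) (h2.mono_set hLs) m,
      mul_condVar μ F _ (h1.mono_set hRs) (h2.mono_set hRs) m, e0, eQ, eP]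
    rw [e0] at eI
    have nL : 0 ≤ (μ (cellL A j b)).toReal := ENNReal.toReal_nonneg
    have nR : 0 ≤ (μ (cellR A j b)).toReal := ENNReal.toReal_nonneg
    set IL := ∫ x in cellL A j b, (F x - m) ∂μ
    set IR := ∫ x in cellR A j b, (F x - m) ∂μ
    set PL := (μ (cellL A j b)).toReal
    set PR := (μ (cellR A j b)).toReal
    have hIR : IR = -IL := by linarith
    rcases nL.eq_or_lt with h | h
    · have := zL h.symm
      rw [hIR, this]; simp
    rcases nR.eq_or_lt with h' | h'
    · have := zR h'.symm
      have : IL = 0 := by linarith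
      rw [hIR, this]; simp
    rw [hIR]
    have key : (PL + PR) * (IL ^ 2 / PL + IL ^ 2 / PR) - 4 * IL ^ 2 = IL ^ 2 * (PL - PR) ^ 2 / (PL * PR) := by
      field_simp; ring
    have key2 : 0 ≤ IL ^ 2 * (PL - PR) ^ 2 / (PL * PR) := by positivity
    have key3 : ∀ q r : ℝ, (PL + PR) * (q + r - 0 ^ 2 / (PL + PR) - (q - IL ^ 2 / PL) - (r - (-IL) ^ 2 / PR))
      = (PL + PR) * (IL ^ 2 / PL + IL ^ 2 / PR) := fun q r => by ring
    rw [key3]; linarith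
  · have nn : ∀ B, 0 ≤ (μ B).toReal * condVar μ F B := fun B =>
      mul_nonneg ENNReal.toReal_nonneg (div_nonneg (integral_nonneg fun x => sq_nonneg _) ENNReal.toReal_nonneg)
    have := nn (cellL A j b)
    have := nn (cellR A j b)
    unfold impurity
    linarith

open ProbabilityTheory in
lemma var_bound {p : ℕ} (f : Fin p → ℝ → ℝ) (hf : ∀ k, Continuous (f k)) (a b : Fin p → ℝ)
    (hab : ∀ k, a k < b k) (m : ℝ) :
    ∃ w : Fin p → ℝ, ∑ k, (b k - a k)⁻¹ * ∫ t in (a k)..(b k), |f k t - w k| ^ 2 ≤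
      (∏ k, (b k - a k)⁻¹) * ∫ x in Set.univ.pi (fun k => Icc (a k) (b k)), (∑ k, f k (x k) - m) ^ 2 := by
  have hpos : ∀ k, 0 < b k - a k := fun k => by linarith [hab k]
  set U : Fin p → Measure ℝ := fun k => ENNReal.ofReal (b k - a k)⁻¹ • volume.restrict (Icc (a k) (b k)) with hU
  have hprob : ∀ k, IsProbabilityMeasure (U k) := fun k => ⟨by
    simp only [hU, Measure.smul_apply, Measure.restrict_apply_univ, Real.volume_Icc, smul_eq_mul]
    rw [← ENNReal.ofReal_mul (inv_nonneg.2 (hpos k).le), inv_mul_cancel₀ (hpos k).ne', ENNReal.ofReal_one]⟩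
  have hpi : Measure.pi U = ENNReal.ofReal (∏ k, (b k - a k)⁻¹) •
      volume.restrict (Set.univ.pi (fun k => Icc (a k) (b k))) := by
    apply Measure.pi_eq
    intro s hs
    rw [Measure.smul_apply, Measure.restrict_apply (MeasurableSet.univ_pi hs), ← Set.pi_inter_distrib,
      volume_pi_pi, ENNReal.ofReal_prod_of_nonneg (fun k _ => inv_nonneg.2 (hpos k).le), smul_eq_mul,
      ← Finset.prod_mul_distrib]
    refine Finset.prod_congr rfl fun k _ => ?_
    simp only [hU, Measure.smul_apply, Measure.restrict_apply (hs k), smul_eq_mul]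
  have hmem : ∀ k, MemLp (f k) 2 (U k) := by
    intro k
    apply MemLp.smul_measure _ ENNReal.ofReal_ne_top
    obtain ⟨C, hC⟩ := isCompact_Icc.exists_bound_of_continuousOn (hf k).continuousOn (s := Icc (a k) (b k))
    apply MemLp.of_bound (hf k).aestronglyMeasurable C
    exact (ae_restrict_iff' measurableSet_Icc).2 (Eventually.of_forall hC)
  have hv := variance_sum_pi hmem
  refine ⟨fun k => ∫ t, f k t ∂(U k), ?_⟩
  have l1 : ∑ k, (b k - a k)⁻¹ * ∫ t in (a k)..(b k), |f k t - ∫ t, f k t ∂(U k)| ^ 2 = ∑ k, Var[f k; U k] := by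
    refine Finset.sum_congr rfl fun k _ => ?_
    rw [variance_eq_integral (hf k).measurable.aemeasurable]
    generalize (∫ t, f k t ∂(U k)) = w
    simp only [hU]
    rw [integral_smul_measure, ENNReal.toReal_ofReal (inv_nonneg.2 (hpos k).le), smul_eq_mul,
      intervalIntegral.integral_of_le (hab k).le, ← integral_Icc_eq_integral_Ioc]
    simp only [sq_abs]
  have hmeas : Measurable (∑ k, fun ω : Fin p → ℝ => f k (ω k)) := by
    have : (∑ k, fun ω : Fin p → ℝ => f k (ω k)) = fun ω => ∑ k, f k (ω k) := by ext; simp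
    rw [this]
    apply Finset.measurable_sum
    intro k _
    exact (hf k).measurable.comp (measurable_pi_apply k)
  have hprob' : IsProbabilityMeasure (Measure.pi U) := inferInstance
  rw [l1, ← hv, ← variance_sub_const hmeas.aestronglyMeasurable m]
  refine (variance_le_expectation_sq (hmeas.sub measurable_const).aestronglyMeasurable).trans ?_
  rw [hpi, integral_smul_measure, ENNReal.toReal_ofReal (Finset.prod_nonneg fun k _ => inv_nonneg.2 (hpos k).le),
    smul_eq_mul]
  apply le_of_eq
  congr 2
  ext x
  simp

lemma ord_ae_eq (J : Set ℝ) (hJ : J.OrdConnected) (hb : J ⊆ Icc 0 1) (hne : J.Nonempty) :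
    J =ᵐ[volume] Icc (sInf J) (sSup J) := by
  have b1 : BddBelow J := ⟨0, fun x hx => (hb hx).1⟩
  have b2 : BddAbove J := ⟨1, fun x hx => (hb hx).2⟩
  have s1 : J ⊆ Icc (sInf J) (sSup J) := fun x hx => ⟨csInf_le b1 hx, le_csSup b2 hx⟩
  have s2 : Ioo (sInf J) (sSup J) ⊆ J := by
    rintro x ⟨h1, h2⟩
    obtain ⟨y, hy, hyx⟩ := exists_lt_of_csInf_lt hne h1
    obtain ⟨z, hz, hzx⟩ := exists_lt_of_lt_csSup hne h2
    exact hJ.out hy hz ⟨hyx.le, hzx.le⟩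
  refine s1.eventuallyLE.antisymm ?_
  exact Ioo_ae_eq_Icc.symm.le.trans s2.eventuallyLE

theorem sid_core
    (p : ℕ) (hp : 1 ≤ p)
    (μ : Measure (Fin p → ℝ)) [IsProbabilityMeasure μ]
    (θlo θhi : ℝ) (hθlo : 0 < θlo) (hθhi1 : 1 ≤ θhi)
    (hlo : ENNReal.ofReal θlo • volume.restrict (box p) ≤ μ)
    (hhi : μ ≤ ENNReal.ofReal θhi • volume.restrict (box p))
    (f : Fin p → ℝ → ℝ) (f' : Fin p → ℝ → ℝ) (τ : ℝ) (hτ : 0 < τ)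
    (hf : ∀ k, Continuous (f k))
    (hderiv : ∀ k, ∀ t ∈ Set.Icc (0 : ℝ) 1, HasDerivWithinAt (f k) (f' k t) (Set.Icc (0 : ℝ) 1) t)
    (hLRP : ∀ k, LRPOn (f k) (f' k) (Set.Icc (0 : ℝ) 1) τ)
    (E : Fin p → Set ℝ) (hE : ∀ j, (E j).OrdConnected) (hE1 : ∀ j, E j ⊆ Set.Icc (0 : ℝ) 1) :
      4 * θlo / (p * τ ^ 2 * θhi) * (μ (Set.univ.pi E)).toReal *
          condVar μ (fun u => ∑ k, f k (u k)) (Set.univ.pi E) ≤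
      (⨆ j : Fin p, ⨆ b : ℝ, impurity μ (fun u => ∑ k, f k (u k)) (Set.univ.pi E) j b) := by
  set F : (Fin p → ℝ) → ℝ := fun u => ∑ k, f k (u k) with hFdef
  set A := Set.univ.pi E with hAdef
  have hAm : MeasurableSet A := MeasurableSet.univ_pi fun j => (hE j).measurableSet
  have hAbox : A ⊆ box p := Set.pi_mono fun j _ => hE1 j
  have hbc : IsCompact (box p) := isCompact_univ_pi fun _ => isCompact_Icc
  have hFc : Continuous F := by
    apply continuous_finsetSum
    intro k _
    exact (hf k).comp (continuous_apply k)
  have hci : ∀ G : (Fin p → ℝ) → ℝ, Continuous G → IntegrableOn G A μ := fun G hG =>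
    (hG.continuousOn.integrableOn_compact hbc).mono_set hAbox
  have hciv : ∀ G : (Fin p → ℝ) → ℝ, Continuous G → IntegrableOn G A volume := fun G hG =>
    (hG.continuousOn.integrableOn_compact hbc).mono_set hAbox
  rcases (ENNReal.toReal_nonneg : 0 ≤ (μ A).toReal).eq_or_lt with h0 | hP
  · have hz : ∀ j b, impurity μ F A j b = 0 := by
      intro j b
      have hL : (μ (cellL A j b)).toReal = 0 := le_antisymm
        ((ENNReal.toReal_mono (measure_ne_top _ _) (measure_mono inter_subset_left)).trans h0.ge) ENNReal.toReal_nonneg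
      have hR : (μ (cellR A j b)).toReal = 0 := le_antisymm
        ((ENNReal.toReal_mono (measure_ne_top _ _) (measure_mono inter_subset_left)).trans h0.ge) ENNReal.toReal_nonneg
      simp only [impurity, hL, hR, ← h0]; ring
    simp only [hz, ← h0]
    simp
  have hbd := impurity_bounds μ F A hAm (hci F hFc) (hci _ (hFc.pow 2)) hP
  have hp0 : Nonempty (Fin p) := ⟨⟨0, hp⟩⟩
  set D := ⨆ j : Fin p, ⨆ b : ℝ, impurity μ F A j b with hD
  have hleD : ∀ j b, impurity μ F A j b ≤ D := by
    intro j b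
    have q1 : impurity μ F A j b ≤ ⨆ b : ℝ, impurity μ F A j b :=
      le_ciSup (f := fun b => impurity μ F A j b) ⟨_, by rintro _ ⟨b, rfl⟩; exact (hbd j b).2⟩ b
    exact q1.trans (le_ciSup (f := fun j => ⨆ b : ℝ, impurity μ F A j b) (Set.finite_range _).bddAbove j)
  set P := (μ A).toReal with hPdef
  set m := condMean μ F A with hm
  set V := ∫ x in A, (F x - m) ^ 2 ∂μ with hV
  have hVe : P * condVar μ F A = V := by
    unfold condVar; rw [← hm, ← hPdef]; field_simp; rfl
  have hVnn : 0 ≤ V := integral_nonneg fun x => sq_nonneg _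
  have hD0 : 0 ≤ D := by
    have := (hbd ⟨0, hp⟩ 0).1
    have : 0 ≤ impurity μ F A ⟨0, hp⟩ 0 := by
      by_contra hc
      have : P * impurity μ F A ⟨0, hp⟩ 0 < 0 := mul_neg_of_pos_of_neg hP (not_le.1 hc)
      nlinarith [sq_nonneg (∫ x in cellL A ⟨0, hp⟩ 0, (F x - m) ∂μ)]
    exact this.trans (hleD _ _)
  have e0 : ∫ x in A, (F x - m) ∂μ = 0 := by
    rw [integral_sub (hci F hFc) (integrable_const m), setIntegral_const, hm, condMean]
    simp only [Measure.real, smul_eq_mul]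
    rw [← hPdef]
    field_simp
    ring
  -- volumes
  have hne : ∀ j, (E j).Nonempty := by
    have : A.Nonempty := by
      by_contra hc
      rw [Set.not_nonempty_iff_eq_empty] at hc
      rw [hPdef, hc] at hP; simp at hP
    exact fun j => (Set.univ_pi_nonempty_iff.1 this) j
  set a : Fin p → ℝ := fun j => sInf (E j) with ha
  set b : Fin p → ℝ := fun j => sSup (E j) with hb
  have hae : ∀ j, E j =ᵐ[volume] Icc (a j) (b j) := fun j => ord_ae_eq _ (hE j) (hE1 j) (hne j)
  have hEab : ∀ j, E j ⊆ Icc (a j) (b j) := fun j x hx =>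
    ⟨csInf_le ⟨0, fun x hx => (hE1 j hx).1⟩ hx, le_csSup ⟨1, fun x hx => (hE1 j hx).2⟩ hx⟩
  have hab01 : ∀ j, Icc (a j) (b j) ⊆ Icc 0 1 := by
    intro j
    apply Icc_subset_Icc
    · exact le_csInf (hne j) fun x hx => (hE1 j hx).1
    · exact csSup_le (hne j) fun x hx => (hE1 j hx).2
  have hAae : A =ᵐ[volume] Set.univ.pi (fun j => Icc (a j) (b j)) :=
    Measure.ae_eq_set_pi fun j _ => hae j
  have hvolA : volume A = ∏ j, ENNReal.ofReal (b j - a j) := by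
    rw [measure_congr hAae, volume_pi_pi]; simp
  have hμA : μ A ≤ ENNReal.ofReal θhi * volume A := by
    refine (hhi A).trans ?_
    rw [Measure.smul_apply, Measure.restrict_apply hAm, inter_eq_left.2 hAbox, smul_eq_mul]
  have hμA0 : μ A ≠ 0 := by
    intro h; rw [hPdef, h] at hP; simp at hP
  have hab : ∀ j, a j < b j := by
    intro j
    by_contra hc
    apply hμA0
    have : volume A = 0 := by
      rw [hvolA]
      exact Finset.prod_eq_zero (Finset.mem_univ j) (ENNReal.ofReal_eq_zero.2 (by linarith))
    rw [this, mul_zero] at hμA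
    exact le_antisymm hμA bot_le
  have hpos : ∀ k, 0 < b k - a k := fun k => by linarith [hab k]
  set W : ℝ := ∏ j, (b j - a j) with hW
  have hWpos : 0 < W := Finset.prod_pos fun j _ => hpos j
  have hPW : P ≤ θhi * W := by
    rw [hvolA, ← ENNReal.ofReal_prod_of_nonneg (fun j _ => (hpos j).le), ← ENNReal.ofReal_mul (by linarith)] at hμA
    exact ENNReal.toReal_le_of_le_ofReal (by positivity) hμA
  -- integration by parts
  set T : Fin p → ℝ := fun k => ∫ t in (a k)..(b k), |f' k t| with hT
  have hTnn : ∀ k, 0 ≤ T k := fun k =>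
    intervalIntegral.integral_nonneg (hab k).le fun _ _ => abs_nonneg _
  set S := Real.sqrt (P * D / 4) with hS
  have hibp : ∀ k, |∫ x in A, (F x - m) * f k (x k) ∂μ| ≤ S * T k := by
    intro k
    have hint : IntegrableOn (f' k) (Icc (a k) (b k)) :=
      (lrp_integrable (f k) (f' k) τ hτ (hf k) (hderiv k) (hLRP k)).mono_set (hab01 k)
    refine ibp_bound (μ.restrict A) (fun x => F x - m) ((hci F hFc).sub (integrable_const m)) e0
      (fun x => x k) (measurable_pi_apply k) (a k) (b k) (hab k).le ?_ (f k) (f' k) hint ?_ S ?_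
    · refine (ae_restrict_iff' hAm).2 (Eventually.of_forall fun x hx => hEab k (hx k (mem_univ k)))
    · intro x hx
      have hsub : Icc x (b k) ⊆ Icc (a k) (b k) := Icc_subset_Icc_left hx.1
      rw [intervalIntegral.integral_eq_sub_of_hasDerivAt_of_le hx.2 (hf k).continuousOn]
      · ring
      · intro t ht
        have ht1 := (hab01 k) (hsub (Ioo_subset_Icc_self ht))
        refine (hderiv k t ht1).hasDerivAt (Icc_mem_nhds ?_ ?_)
        · exact lt_of_le_of_lt ((hab01 k) hx).1 ht.1
        · exact lt_of_lt_of_le ht.2 ((hab01 k) (right_mem_Icc.2 (hab k).le)).2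
      · rw [intervalIntegrable_iff_integrableOn_Icc_of_le hx.2]
        exact hint.mono_set hsub
    · intro t
      rw [Measure.restrict_restrict (measurableSet_le (measurable_pi_apply k) measurable_const), inter_comm]
      apply Real.abs_le_sqrt
      have q1 := (hbd k t).1
      have q2 := mul_le_mul_of_nonneg_left (hleD k t) hP.le
      unfold cellL at q1
      linarith
  have hVsum : V = ∑ k, ∫ x in A, (F x - m) * f k (x k) ∂μ := by
    rw [← integral_finsetSum]
    · have : ∀ x, ∑ k, (F x - m) * f k (x k) = (F x - m) ^ 2 + m * (F x - m) := by
        intro x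
        rw [← Finset.mul_sum]
        change (F x - m) * F x = _
        ring
      simp_rw [this]
      rw [integral_add (hci _ (by fun_prop)) (hci _ (by fun_prop)), integral_const_mul, e0]
      simp [hV]
    · intro k _
      exact hci _ ((hFc.sub continuous_const).mul ((hf k).comp (continuous_apply k)))
  have hV1 : V ≤ S * ∑ k, T k := by
    rw [hVsum, Finset.mul_sum]
    exact Finset.sum_le_sum fun k _ => (le_abs_self _).trans (hibp k)
  -- Lebesgue variance
  obtain ⟨w, hw⟩ := var_bound f hf a b hab m
  set Q := ∫ x in A, (F x - m) ^ 2 with hQ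
  have hQe : ∫ x in Set.univ.pi (fun k => Icc (a k) (b k)), (∑ k, f k (x k) - m) ^ 2 = Q :=
    (setIntegral_congr_set hAae).symm
  have hprodinv : ∏ k, (b k - a k)⁻¹ = W⁻¹ := by rw [hW, Finset.prod_inv_distrib]
  rw [hQe, hprodinv] at hw
  have hT2 : ∑ k, T k ^ 2 ≤ τ ^ 2 * (W⁻¹ * Q) := by
    refine le_trans ?_ (mul_le_mul_of_nonneg_left hw (sq_nonneg τ))
    rw [Finset.mul_sum]
    refine Finset.sum_le_sum fun k _ => ?_
    have := (hLRP k).le (a k) (b k) (hab k) (hab01 k) (w k)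
    rw [div_eq_mul_inv, mul_assoc] at this
    exact this
  have hQV : θlo * Q ≤ V := by
    have hle : ENNReal.ofReal θlo • volume.restrict A ≤ μ.restrict A := by
      have := Measure.restrict_mono_measure hlo A
      rwa [Measure.restrict_smul, Measure.restrict_restrict hAm, inter_eq_left.2 hAbox] at this
    have := integral_mono_measure hle (Eventually.of_forall fun x => sq_nonneg (F x - m))
      (hci (fun x => (F x - m) ^ 2) (by fun_prop))
    rwa [integral_smul_measure, ENNReal.toReal_ofReal hθlo.le, smul_eq_mul] at this
  -- conclusion
  have hpR : (0 : ℝ) < p := by exact_mod_cast hp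
  have hTs : (∑ k, T k) ^ 2 ≤ p * ∑ k, T k ^ 2 := by
    have := sq_sum_le_card_mul_sum_sq (s := (Finset.univ : Finset (Fin p))) (f := T)
    simpa using this
  rw [mul_assoc, hVe]
  rcases hVnn.eq_or_lt with hV0 | hVpos
  · rw [← hV0, mul_zero]; exact hD0
  have hS2 : S ^ 2 = P * D / 4 := Real.sq_sqrt (by positivity)
  have hfin : V * V ≤ (θhi * D * p * τ ^ 2 / (4 * θlo)) * V := by
    calc V * V = V ^ 2 := by ring
      _ ≤ (S * ∑ k, T k) ^ 2 := by gcongr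
      _ = P * D / 4 * (∑ k, T k) ^ 2 := by rw [mul_pow, hS2]
      _ ≤ (θhi * W) * D / 4 * (p * (τ ^ 2 * (W⁻¹ * (V / θlo)))) := by
        gcongr
        refine hTs.trans ?_
        gcongr
        refine hT2.trans ?_
        gcongr
        rw [le_div_iff₀ hθlo]; linarith
      _ = _ := by field_simp
  have hfin2 := le_of_mul_le_mul_right hfin hVpos
  have hθhi : 0 < θhi := by linarith
  calc 4 * θlo / (p * τ ^ 2 * θhi) * V ≤ 4 * θlo / (p * τ ^ 2 * θhi) * (θhi * D * p * τ ^ 2 / (4 * θlo)) := by gcongr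
    _ = D := by field_simp

lemma condVar_congr {p : ℕ} (μ : Measure (Fin p → ℝ)) (F G : (Fin p → ℝ) → ℝ)
    (B : Set (Fin p → ℝ)) (hB : MeasurableSet B) (h : ∀ x ∈ B, F x = G x) :
    condVar μ F B = condVar μ G B := by
  have h1 : condMean μ F B = condMean μ G B := by
    unfold condMean
    rw [setIntegral_congr_fun hB h]
  unfold condVar
  rw [h1, setIntegral_congr_fun (g := fun x => (G x - condMean μ G B) ^ 2) hB (fun x hx => by simp only [h x hx])]

lemma impurity_congr {p : ℕ} (μ : Measure (Fin p → ℝ)) (F G : (Fin p → ℝ) → ℝ)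
    (A : Set (Fin p → ℝ)) (hA : MeasurableSet A) (h : ∀ x ∈ A, F x = G x) (j : Fin p) (b : ℝ) :
    impurity μ F A j b = impurity μ G A j b := by
  unfold impurity
  rw [condVar_congr μ F G A hA h,
    condVar_congr μ F G (cellL A j b) (hA.inter (measurableSet_le (measurable_pi_apply j) measurable_const))
      (fun x hx => h x hx.1),
    condVar_congr μ F G (cellR A j b) (hA.inter (measurableSet_lt measurable_const (measurable_pi_apply j)))
      (fun x hx => h x hx.1)]

/-- **Proposition (SID from additive LRP components).**
If `μ` has a density bounded between `θlo` and `θhi` on `[0,1]^p`, and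
`f*(u) = ∑ k f_k(u_k)` with each component in `LRP([0,1], τ)`, then the sufficient impurity
decrease condition holds with `λ = 4θlo/(p τ² θhi)`: for every rectangle
`A = ∏ⱼ Eⱼ ⊆ [0,1]^p` (a product of intervals),
`sup_{j,b} Δ(A,j,b) ≥ λ · P(X∈A) · Var(f*(X)|X∈A)`. -/
theorem sid_of_additive_lrp
    (p : ℕ) (hp : 1 ≤ p)
    (μ : Measure (Fin p → ℝ)) [IsProbabilityMeasure μ]
    (pX : (Fin p → ℝ) → ℝ) (θlo θhi : ℝ)
    (hθlo : 0 < θlo) (hθlo1 : θlo ≤ 1) (hθhi1 : 1 ≤ θhi)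
    (hdens : μ = (volume.restrict (box p)).withDensity fun u => ENNReal.ofReal (pX u))
    (hbound : ∀ u ∈ box p, θlo ≤ pX u ∧ pX u ≤ θhi)
    (f : Fin p → ℝ → ℝ) (f' : Fin p → ℝ → ℝ) (τ : ℝ) (hτ : 0 < τ)
    (hderiv : ∀ k, ∀ t ∈ Set.Icc (0 : ℝ) 1, HasDerivWithinAt (f k) (f' k t) (Set.Icc (0 : ℝ) 1) t)
    (hLRP : ∀ k, LRPOn (f k) (f' k) (Set.Icc (0 : ℝ) 1) τ)
    (fstar : (Fin p → ℝ) → ℝ)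
    (hadd : ∀ u, fstar u = ∑ k, f k (u k)) :
    ∀ E : Fin p → Set ℝ, (∀ j, (E j).OrdConnected) → (∀ j, E j ⊆ Set.Icc (0 : ℝ) 1) →
      (⨆ j : Fin p, ⨆ b : ℝ, impurity μ fstar (Set.univ.pi E) j b) ≥
        4 * θlo / (p * τ ^ 2 * θhi) * (μ (Set.univ.pi E)).toReal *
          condVar μ fstar (Set.univ.pi E) := by
  intro E hE hE1
  have hbm : MeasurableSet (box p) := MeasurableSet.univ_pi fun _ => measurableSet_Icc
  have hlo : ENNReal.ofReal θlo • volume.restrict (box p) ≤ μ := by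
    rw [hdens, ← withDensity_const]
    apply withDensity_mono
    exact (ae_restrict_iff' hbm).2 (Eventually.of_forall fun u hu => ENNReal.ofReal_le_ofReal (hbound u hu).1)
  have hhi : μ ≤ ENNReal.ofReal θhi • volume.restrict (box p) := by
    rw [hdens, ← withDensity_const]
    apply withDensity_mono
    exact (ae_restrict_iff' hbm).2 (Eventually.of_forall fun u hu => ENNReal.ofReal_le_ofReal (hbound u hu).2)
  have h01 : (0 : ℝ) ≤ 1 := zero_le_one
  set g : Fin p → ℝ → ℝ := fun k t => f k (projIcc 0 1 h01 t) with hg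
  have hgf : ∀ k, ∀ t ∈ Icc (0:ℝ) 1, g k t = f k t := fun k t ht => by
    simp only [hg, projIcc_of_mem h01 ht]
  have hgc : ∀ k, Continuous (g k) := fun k =>
    ContinuousOn.comp_continuous (s := Icc (0:ℝ) 1) (fun t ht => (hderiv k t ht).continuousWithinAt)
      (continuous_subtype_val.comp continuous_projIcc) (fun t => (projIcc 0 1 h01 t).2)
  have hcore := sid_core p hp μ θlo θhi hθlo hθhi1 hlo hhi g f' τ hτ hgc
    (fun k t ht => (hderiv k t ht).congr (hgf k) (hgf k t ht))
    (by
      intro k a b hab hs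
      have := hLRP k a b hab hs
      have e : ∀ w : ℝ, ∫ t in a..b, |g k t - w| ^ 2 = ∫ t in a..b, |f k t - w| ^ 2 := by
        intro w
        apply intervalIntegral.integral_congr
        intro t ht
        rw [uIcc_of_le hab.le] at ht
        simp only [hgf k t (hs ht)]
      simp_rw [e]
      exact this) E hE hE1
  have hAm : MeasurableSet (Set.univ.pi E) := MeasurableSet.univ_pi fun j => (hE j).measurableSet
  have heq : ∀ x ∈ Set.univ.pi E, fstar x = ∑ k, g k (x k) := by
    intro x hx
    rw [hadd]
    exact Finset.sum_congr rfl fun k _ => (hgf k _ (hE1 k (hx k (mem_univ k)))).symm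
  rw [condVar_congr μ fstar _ _ hAm heq]
  simp_rw [impurity_congr μ fstar _ _ hAm heq]
  exact hcore
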